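/- arXiv:2204.03587 — 2 statements merged into one kernel-verified Lean document; each statement's English description precedes it below -/
import Mathlib

section
/- Let M be a bounded open subset of ℝ² with finite Lebesgue measure λ. Let A₁, A₂ be disjoint measurable subsets of M with A₁ ∪ A₂ = M and λ(A₁) = λ(A₂) = λ(M)/2, and let ω₀ = −𝟙_{A₁} + 𝟙_{A₂}. Then for ω ∈ L^∞(M) the following are equivalent: (a) there exists a bistochastic kernel K on M with ω = Kω₀ almost everywhere; (b) |ω| ≤ 1 almost everywhere and ∫_M ω dλ = 0. -/
open MeasureTheory ProbabilityTheory

/-- A bistochastic kernel on a measure space `(X, μ)`. -/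
def IsBistochastic {X : Type*} [MeasurableSpace X] (μ : Measure X)
    (κ : Kernel X X) : Prop :=
  IsMarkovKernel κ ∧ ∀ A : Set X, MeasurableSet A → ∫⁻ x, κ x A ∂μ = μ A

/-- `(Kω)(x) := ∫ ω(y) dκ_x(y)`. -/
noncomputable def kernApply {X : Type*} [MeasurableSpace X]
    (κ : Kernel X X) (ω : X → ℝ) (x : X) : ℝ :=
  ∫ y, ω y ∂(κ x)

section Bistochastic

variable {X : Type*} [MeasurableSpace X] {μ : Measure X}

lemma IsBistochastic.bind_eq {κ : Kernel X X} (hκ : IsBistochastic μ κ) : μ.bind κ = μ := by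
  ext s hs
  rw [Measure.bind_apply hs κ.measurable.aemeasurable, hκ.2 s hs]

lemma IsBistochastic.integral_kernApply {κ : Kernel X X} (hκ : IsBistochastic μ κ) {u : X → ℝ}
    (hu : Integrable u μ) : ∫ x, kernApply κ u x ∂μ = ∫ x, u x ∂μ := by
  have hcomp : (κ ∘ₖ Kernel.const Unit μ) () = μ := by
    rw [Kernel.comp_apply, Kernel.const_apply, hκ.bind_eq]
  have h := Kernel.integral_comp (η := κ) (κ := Kernel.const Unit μ) (a := ()) (f := u)
    (by rwa [hcomp])
  rw [hcomp] at h
  exact h.symm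

lemma IsBistochastic.abs_kernApply_le {κ : Kernel X X} (hκ : IsBistochastic μ κ) {u : X → ℝ}
    {C : ℝ} (hu : ∀ x, |u x| ≤ C) (x : X) : |kernApply κ u x| ≤ C := by
  have := hκ.1
  simpa [kernApply] using norm_integral_le_of_norm_le_const (μ := κ x) (f := u) (.of_forall hu)

/-- The kernel mixing the conditional laws of `μ` on `A` and on `Aᶜ` with weights
`f x` and `1 - f x`. -/
noncomputable def mixtureKernel (μ : Measure X) (A : Set X) (f : X → ℝ) (hf : Measurable f) :
    Kernel X X where
  toFun x := ENNReal.ofReal (f x) • μ[|A] + ENNReal.ofReal (1 - f x) • μ[|Aᶜ]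
  measurable' := by
    refine Measure.measurable_of_measurable_coe _ fun s _ => ?_
    simp only [Measure.coe_add, Measure.coe_smul, Pi.add_apply, Pi.smul_apply, smul_eq_mul]
    fun_prop

lemma mixtureKernel_apply {A : Set X} {f : X → ℝ} (hf : Measurable f) (x : X) :
    mixtureKernel μ A f hf x
      = ENNReal.ofReal (f x) • μ[|A] + ENNReal.ofReal (1 - f x) • μ[|Aᶜ] := rfl

lemma isBistochastic_mixtureKernel [IsFiniteMeasure μ] {A : Set X} (hA : MeasurableSet A)
    (hA0 : μ A ≠ 0) (hAc0 : μ Aᶜ ≠ 0) {f : X → ℝ} (hf : Measurable f)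
    (hf01 : ∀ x, f x ∈ Set.Icc 0 1) (hint : ∫ x, f x ∂μ = μ.real A) :
    IsBistochastic μ (mixtureKernel μ A f hf) := by
  have := cond_isProbabilityMeasure hA0
  have := cond_isProbabilityMeasure hAc0
  have hfi : Integrable f μ := .of_mem_Icc 0 1 hf.aemeasurable (.of_forall hf01)
  have hp : ∫⁻ x, ENNReal.ofReal (f x) ∂μ = μ A := by
    rw [← ofReal_integral_eq_lintegral_ofReal hfi (.of_forall fun x => (hf01 x).1), hint,
      ofReal_measureReal]
  have hq : ∫⁻ x, ENNReal.ofReal (1 - f x) ∂μ = μ Aᶜ := by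
    have hfi' : Integrable (fun x => 1 - f x) μ := (integrable_const _).sub hfi
    rw [← ofReal_integral_eq_lintegral_ofReal hfi'
      (.of_forall fun x => sub_nonneg.2 (hf01 x).2), integral_sub (integrable_const _) hfi, hint,
      integral_const, smul_eq_mul, mul_one, ← measureReal_compl hA, ofReal_measureReal]
  refine ⟨⟨fun x => ⟨?_⟩⟩, fun B _ => ?_⟩
  · rw [mixtureKernel_apply]
    simp only [Measure.coe_add, Measure.coe_smul, Pi.add_apply, Pi.smul_apply, smul_eq_mul,
      measure_univ, mul_one]
    rw [← ENNReal.ofReal_add (hf01 x).1 (sub_nonneg.2 (hf01 x).2), add_sub_cancel,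
      ENNReal.ofReal_one]
  · simp only [mixtureKernel_apply, Measure.coe_add, Measure.coe_smul, Pi.add_apply,
      Pi.smul_apply, smul_eq_mul]
    rw [lintegral_add_left (by fun_prop), lintegral_mul_const _ (by fun_prop),
      lintegral_mul_const _ (by fun_prop), hp, hq, mul_comm, mul_comm (μ Aᶜ)]
    exact cond_add_cond_compl_eq hA μ

lemma kernApply_mixtureKernel [IsFiniteMeasure μ] {A : Set X} (hA : MeasurableSet A)
    (hA0 : μ A ≠ 0) (hAc0 : μ Aᶜ ≠ 0) {f : X → ℝ} (hf : Measurable f)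
    (hf01 : ∀ x, f x ∈ Set.Icc 0 1) {u : X → ℝ} {a b : ℝ}
    (ha : ∀ᵐ y ∂μ, y ∈ A → u y = a) (hb : ∀ᵐ y ∂μ, y ∉ A → u y = b) (x : X) :
    kernApply (mixtureKernel μ A f hf) u x = f x * a + (1 - f x) * b := by
  have := cond_isProbabilityMeasure hA0
  have := cond_isProbabilityMeasure hAc0
  have ha' : u =ᵐ[μ[|A]] fun _ => a := by
    filter_upwards [cond_absolutelyContinuous.ae_le ha, ae_cond_mem hA] with y h1 h2 using h1 h2
  have hb' : u =ᵐ[μ[|Aᶜ]] fun _ => b := by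
    filter_upwards [cond_absolutelyContinuous.ae_le hb, ae_cond_mem hA.compl] with y h1 h2
      using h1 h2
  rw [kernApply, mixtureKernel_apply, integral_add_measure
    (((integrable_const a).congr ha'.symm).smul_measure ENNReal.ofReal_ne_top)
    (((integrable_const b).congr hb'.symm).smul_measure ENNReal.ofReal_ne_top),
    integral_smul_measure, integral_smul_measure, integral_congr_ae ha', integral_congr_ae hb',
    ENNReal.toReal_ofReal (hf01 x).1, ENNReal.toReal_ofReal (sub_nonneg.2 (hf01 x).2)]
  simp

end Bistochastic

/-- for two opposite patches of equal area,
`ω₀ = -𝟙_{A₁} + 𝟙_{A₂}`, the weak-* closure of the orbit consists exactly of all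
`ω` with `|ω| ≤ 1` a.e. and zero mean. -/
theorem two_patch_orbit_characterization
    (M : Set (ℝ × ℝ)) (hMopen : IsOpen M) (hMbdd : Bornology.IsBounded M)
    (A₁ A₂ : Set (ℝ × ℝ)) (hA₁ : MeasurableSet A₁) (hA₂ : MeasurableSet A₂)
    (hdisj : Disjoint A₁ A₂) (hcover : A₁ ∪ A₂ = M)
    (hhalf₁ : volume A₁ = volume M / 2) (hhalf₂ : volume A₂ = volume M / 2)
    (ω₀ : ℝ × ℝ → ℝ)
    (hω₀ : ω₀ = fun x => A₂.indicator (fun _ => (1:ℝ)) x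
        - A₁.indicator (fun _ => (1:ℝ)) x)
    (ω : ℝ × ℝ → ℝ) (hω : MemLp ω ⊤ (volume.restrict M)) :
    (∃ κ : Kernel (ℝ × ℝ) (ℝ × ℝ), IsBistochastic (volume.restrict M) κ ∧
        ω =ᵐ[volume.restrict M] kernApply κ ω₀) ↔
    ((∀ᵐ x ∂(volume.restrict M), |ω x| ≤ 1) ∧
      ∫ x, ω x ∂(volume.restrict M) = 0) := by
  have : IsFiniteMeasure (volume.restrict M) := ⟨by simpa using hMbdd.measure_lt_top⟩
  have hM : MeasurableSet M := hMopen.measurableSet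
  have hμ₁ : volume.restrict M A₁ = volume M / 2 := by
    rw [Measure.restrict_apply hA₁, Set.inter_eq_left.2 (hcover ▸ Set.subset_union_left), hhalf₁]
  have hμ₂ : volume.restrict M A₂ = volume M / 2 := by
    rw [Measure.restrict_apply hA₂, Set.inter_eq_left.2 (hcover ▸ Set.subset_union_right), hhalf₂]
  have hval₂ : ∀ y ∈ A₂, ω₀ y = 1 := fun y hy => by
    simp [hω₀, hy, Set.disjoint_right.1 hdisj hy]
  have hval₁ : ∀ y ∈ A₁, ω₀ y = -1 := fun y hy => by
    simp [hω₀, hy, Set.disjoint_left.1 hdisj hy]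
  constructor
  · rintro ⟨κ, hκ, hωκ⟩
    have hbound : ∀ x, |ω₀ x| ≤ 1 := fun x => by
      by_cases h₂ : x ∈ A₂
      · simp [hval₂ x h₂]
      by_cases h₁ : x ∈ A₁
      · simp [hval₁ x h₁]
      simp [hω₀, h₁, h₂]
    have hi₁ : Integrable (A₁.indicator fun _ => (1 : ℝ)) (volume.restrict M) :=
      (integrable_const _).indicator hA₁
    have hi₂ : Integrable (A₂.indicator fun _ => (1 : ℝ)) (volume.restrict M) :=
      (integrable_const _).indicator hA₂
    refine ⟨?_, ?_⟩
    · filter_upwards [hωκ] with x hx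
      exact hx ▸ hκ.abs_kernApply_le hbound x
    · rw [integral_congr_ae hωκ, hκ.integral_kernApply (hω₀ ▸ hi₂.sub hi₁), hω₀,
        integral_sub hi₂ hi₁, integral_indicator_const _ hA₂, integral_indicator_const _ hA₁,
        measureReal_def, measureReal_def, hμ₁, hμ₂, sub_self]
  · rintro ⟨hle, hmean⟩
    rcases eq_or_ne (volume M) 0 with h0 | h0
    · rw [Measure.restrict_eq_zero.2 h0]
      exact ⟨Kernel.id, ⟨inferInstance, by simp⟩, by simp [Filter.EventuallyEq]⟩
    have hhalf0 : volume M / 2 ≠ 0 := by simp [h0]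
    have hcompl : volume.restrict M A₂ᶜ ≠ 0 := fun h =>
      hhalf0 (hμ₁ ▸ measure_mono_null hdisj.subset_compl_right h)
    obtain ⟨g, hg, hωg⟩ := hω.1.aemeasurable
    let f : ℝ × ℝ → ℝ := fun x => (1 + max (-1) (min 1 (g x))) / 2
    have hf : Measurable f := by fun_prop
    have hf01 : ∀ x, f x ∈ Set.Icc 0 1 := fun x => by
      have h1 : -1 ≤ max (-1) (min 1 (g x)) := le_max_left _ _
      have h2 : max (-1) (min 1 (g x)) ≤ 1 := max_le (by norm_num) (min_le_left _ _)
      constructor <;> simp only [f] <;> linarith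
    have hfω : f =ᵐ[volume.restrict M] fun x => (1 + ω x) / 2 := by
      filter_upwards [hωg, hle] with x hx hx1
      simp only [f]
      rw [← hx, min_eq_right (abs_le.1 hx1).2, max_eq_right (abs_le.1 hx1).1]
    have hint : ∫ x, f x ∂(volume.restrict M) = (volume.restrict M).real A₂ := by
      rw [integral_congr_ae hfω, integral_div,
        integral_add (integrable_const _) (hω.integrable le_top), hmean, measureReal_def, hμ₂]
      simp [measureReal_def]
    refine ⟨mixtureKernel _ A₂ f hf, isBistochastic_mixtureKernel hA₂ (hμ₂ ▸ hhalf0) hcompl hf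
      hf01 hint, ?_⟩
    have hmem : ∀ᵐ y ∂(volume.restrict M), y ∉ A₂ → ω₀ y = -1 := by
      filter_upwards [ae_restrict_mem hM] with y hy hy₂
      exact hval₁ y ((hcover.symm ▸ hy : y ∈ A₁ ∪ A₂).resolve_right hy₂)
    filter_upwards [hfω] with x hx
    rw [kernApply_mixtureKernel hA₂ (hμ₂ ▸ hhalf0) hcompl hf hf01 (.of_forall hval₂) hmem, hx]
    ring
end

section
/- Let M be a bounded open subset of ℝ² with finite Lebesgue measure λ and let ω₀ ∈ L^∞(M). Then the set 𝒦_{ω₀} := { ω ∈ L¹(M) : ω = Kω₀ almost everywhere for some bistochastic kernel K on M } is convex, and it is closed in the weak topology σ(L¹, L^∞) of L¹(M): if (ω_n) ⊂ 𝒦_{ω₀} and ∫_M g ω_n dλ → ∫_M g ω dλ for every g ∈ L^∞(M), then ω ∈ 𝒦_{ω₀}. -/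
open MeasureTheory ProbabilityTheory

open Filter Topology
open scoped ENNReal NNReal BoundedContinuousFunction

section Bistochastic

variable {X : Type*} [MeasurableSpace X] {μ : Measure X}

lemma IsBistochastic.snd_compProd [SFinite μ] {κ : Kernel X X} (h : IsBistochastic μ κ) :
    (μ ⊗ₘ κ).snd = μ := by
  have := h.1
  ext A hA
  rw [Measure.snd_apply hA, Measure.compProd_apply (measurable_snd hA), ← h.2 A hA]
  rfl

lemma isBistochastic_of_snd_compProd [SFinite μ] {κ : Kernel X X} [IsMarkovKernel κ]
    (h : (μ ⊗ₘ κ).snd = μ) : IsBistochastic μ κ := by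
  refine ⟨inferInstance, fun A hA ↦ ?_⟩
  conv_rhs => rw [← h, Measure.snd_apply hA, Measure.compProd_apply (measurable_snd hA)]
  rfl

lemma integrable_comp_snd {π : Measure (X × X)} (hπ : π.snd = μ) {f : X → ℝ}
    (hf : Integrable f μ) : Integrable (fun z ↦ f z.2) π := by
  subst hπ
  exact hf.comp_measurable measurable_snd

lemma integral_comp_snd {π : Measure (X × X)} (hπ : π.snd = μ) {f : X → ℝ}
    (hf : AEStronglyMeasurable f μ) : ∫ z, f z.2 ∂π = ∫ y, f y ∂μ := by
  subst hπ
  exact (integral_map measurable_snd.aemeasurable hf).symm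

lemma IsBistochastic.ae_integrable [SFinite μ] {κ : Kernel X X} (h : IsBistochastic μ κ)
    {f : X → ℝ} (hf : Integrable f μ) : ∀ᵐ x ∂μ, Integrable f (κ x) := by
  have := h.1
  have hint := integrable_comp_snd h.snd_compProd hf
  exact ((Measure.integrable_compProd_iff hint.aestronglyMeasurable).1 hint).1

lemma IsBistochastic.integrable_kernApply [SFinite μ] {κ : Kernel X X}
    (h : IsBistochastic μ κ) {f : X → ℝ} (hf : Integrable f μ) :
    Integrable (kernApply κ f) μ := by
  have := h.1
  have hint := integrable_comp_snd h.snd_compProd hf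
  rw [Measure.compProd] at hint
  simpa using! hint.integral_compProd

/-- The combination `a • κ + b • η` of two kernels. -/
noncomputable def convexCombKernel (a b : ℝ≥0∞) (κ η : Kernel X X) : Kernel X X where
  toFun x := a • κ x + b • η x
  measurable' := by
    refine Measure.measurable_of_measurable_coe _ fun s hs ↦ ?_
    simpa [Pi.add_def] using ((κ.measurable_coe hs).const_mul a).add ((η.measurable_coe hs).const_mul b)

lemma convexCombKernel_apply (a b : ℝ≥0∞) (κ η : Kernel X X) (x : X) :
    convexCombKernel a b κ η x = a • κ x + b • η x := rfl

lemma IsBistochastic.convexComb {κ η : Kernel X X} (hκ : IsBistochastic μ κ)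
    (hη : IsBistochastic μ η) {a b : ℝ≥0∞} (hab : a + b = 1) :
    IsBistochastic μ (convexCombKernel a b κ η) := by
  have := hκ.1
  have := hη.1
  refine ⟨⟨fun x ↦ ⟨by simp [convexCombKernel_apply, hab]⟩⟩, fun A hA ↦ ?_⟩
  simp only [convexCombKernel_apply, Measure.add_apply, Measure.smul_apply, smul_eq_mul]
  rw [lintegral_add_left ((κ.measurable_coe hA).const_mul a),
    lintegral_const_mul _ (κ.measurable_coe hA), lintegral_const_mul _ (η.measurable_coe hA),
    hκ.2 A hA, hη.2 A hA, ← add_mul, hab, one_mul]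

lemma kernApply_convexCombKernel {κ η : Kernel X X} {f : X → ℝ} {x : X}
    (hκ : Integrable f (κ x)) (hη : Integrable f (η x)) {a b : ℝ≥0∞} (ha : a ≠ ∞) (hb : b ≠ ∞) :
    kernApply (convexCombKernel a b κ η) f x
      = a.toReal * kernApply κ f x + b.toReal * kernApply η f x := by
  simp only [kernApply, convexCombKernel_apply]
  rw [integral_add_measure (hκ.smul_measure ha) (hη.smul_measure hb), integral_smul_measure,
    integral_smul_measure, smul_eq_mul, smul_eq_mul]

variable [TopologicalSpace X] [BorelSpace X]

lemma integrable_boundedContinuous_mul_comp_snd {π : Measure (X × X)} (hπ : π.snd = μ)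
    (g : X →ᵇ ℝ) {f : X → ℝ} (hf : Integrable f μ) :
    Integrable (fun z ↦ g z.1 * f z.2) π :=
  (integrable_comp_snd hπ hf).bdd_mul (c := ‖g‖)
    (g.continuous.measurable.comp measurable_fst).aestronglyMeasurable
    (ae_of_all _ fun z ↦ g.norm_coe_le_norm z.1)

lemma IsBistochastic.integral_mul_kernApply [SFinite μ] {κ : Kernel X X}
    (h : IsBistochastic μ κ) (g : X →ᵇ ℝ) {f : X → ℝ} (hf : Integrable f μ) :
    ∫ x, g x * kernApply κ f x ∂μ = ∫ z, g z.1 * f z.2 ∂(μ ⊗ₘ κ) := by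
  have := h.1
  rw [Measure.integral_compProd (integrable_boundedContinuous_mul_comp_snd h.snd_compProd g hf)]
  simp only [kernApply, integral_const_mul]

lemma abs_integral_mul_sub_le {π : Measure (X × X)} (hπ : π.snd = μ) (g : X →ᵇ ℝ) {f f' : X → ℝ}
    (hf : Integrable f μ) (hf' : Integrable f' μ) :
    |∫ z, g z.1 * f z.2 ∂π - ∫ z, g z.1 * f' z.2 ∂π| ≤ ‖g‖ * ∫ y, ‖f y - f' y‖ ∂μ := by
  have hdiff : Integrable (fun y ↦ ‖f y - f' y‖) μ := (hf.sub hf').norm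
  rw [← integral_sub (integrable_boundedContinuous_mul_comp_snd hπ g hf)
    (integrable_boundedContinuous_mul_comp_snd hπ g hf'),
    ← integral_comp_snd hπ hdiff.aestronglyMeasurable, ← integral_const_mul, ← Real.norm_eq_abs]
  refine norm_integral_le_of_norm_le ((integrable_comp_snd hπ hdiff).const_mul _)
    (ae_of_all _ fun z ↦ ?_)
  rw [← mul_sub, norm_mul]
  exact mul_le_mul_of_nonneg_right (g.norm_coe_le_norm _) (norm_nonneg _)

variable [SecondCountableTopology X]

/-- Weak convergence of measures with a fixed second marginal `μ` improves to convergence against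
products of a bounded continuous function and a `μ`-integrable function. -/
lemma tendsto_integral_mul_of_snd_eq [μ.WeaklyRegular] [NormalSpace X] [IsFiniteMeasure μ]
    {ι : Type*} {F : Filter ι} {π : ι → FiniteMeasure (X × X)} {π₀ : FiniteMeasure (X × X)}
    (hlim : Tendsto π F (𝓝 π₀)) (hπ : ∀ i, (π i : Measure (X × X)).snd = μ)
    (hπ₀ : (π₀ : Measure (X × X)).snd = μ) (g : X →ᵇ ℝ) {f : X → ℝ} (hf : Integrable f μ) :
    Tendsto (fun i ↦ ∫ z, g z.1 * f z.2 ∂(π i : Measure (X × X))) F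
      (𝓝 (∫ z, g z.1 * f z.2 ∂(π₀ : Measure (X × X)))) := by
  rw [Metric.tendsto_nhds]
  intro ε hε
  obtain ⟨f', hf'le, hf'⟩ := hf.exists_boundedContinuous_integral_sub_le
    (ε := ε / (3 * (‖g‖ + 1))) (by positivity)
  have hsmall : ‖g‖ * ∫ y, ‖f y - f' y‖ ∂μ < ε / 3 := by
    calc ‖g‖ * ∫ y, ‖f y - f' y‖ ∂μ ≤ ‖g‖ * (ε / (3 * (‖g‖ + 1))) := by gcongr
      _ < (‖g‖ + 1) * (ε / (3 * (‖g‖ + 1))) := by gcongr; linarith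
      _ = ε / 3 := by field_simp
  let G : X × X →ᵇ ℝ := g.compContinuous ⟨Prod.fst, continuous_fst⟩ *
    f'.compContinuous ⟨Prod.snd, continuous_snd⟩
  have hG := FiniteMeasure.tendsto_iff_forall_integral_tendsto.1 hlim G
  filter_upwards [Metric.tendsto_nhds.1 hG (ε / 3) (by positivity)] with i hi
  have hi' : |∫ z, g z.1 * f' z.2 ∂(π i : Measure (X × X)) -
      ∫ z, g z.1 * f' z.2 ∂(π₀ : Measure (X × X))| < ε / 3 := hi
  have h₁ := abs_integral_mul_sub_le (hπ i) g hf hf'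
  have h₂ := abs_integral_mul_sub_le hπ₀ g hf hf'
  rw [Real.dist_eq]
  rw [abs_lt] at *
  rw [abs_le] at h₁ h₂
  constructor <;> linarith

/-- Couplings of `μ` with itself are weakly compact when `μ` lives on a compact set. -/
lemma exists_tendsto_coupling [T2Space X] [HasOuterApproxClosed X]
    {K : Set X} (hK : IsCompact K) (hμK : μ Kᶜ = 0) [IsFiniteMeasure μ]
    {ι : Type*} (F : Ultrafilter ι) (π : ι → FiniteMeasure (X × X))
    (hfst : ∀ i, (π i : Measure (X × X)).fst = μ) (hsnd : ∀ i, (π i : Measure (X × X)).snd = μ) :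
    ∃ π₀ : FiniteMeasure (X × X), Tendsto π F (𝓝 π₀) ∧
      (π₀ : Measure (X × X)).fst = μ ∧ (π₀ : Measure (X × X)).snd = μ := by
  have hmeas := hK.measurableSet
  let m : FiniteMeasure X := ⟨μ, inferInstance⟩
  have hmem : ∀ i, π i ∈ {ν : FiniteMeasure (X × X) | ν.mass ≤ m.mass ∧ ν (K ×ˢ K)ᶜ = 0} := by
    intro i
    refine ⟨?_, ?_⟩
    · rw [← ENNReal.coe_le_coe, FiniteMeasure.ennreal_mass, FiniteMeasure.ennreal_mass,
        ← Measure.fst_univ, hfst i]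
      rfl
    · rw [FiniteMeasure.null_iff_toMeasure_null, Set.compl_prod_eq_union]
      refine measure_union_null ?_ ?_
      · rwa [Set.prod_univ, ← Measure.fst_apply hmeas.compl, hfst i]
      · rwa [Set.univ_prod, ← Measure.snd_apply hmeas.compl, hsnd i]
  obtain ⟨π₀, -, hπ₀⟩ := (isCompact_setOfPred_finiteMeasure_le_of_isCompact m.mass
    (hK.prod hK)).ultrafilter_le_nhds (F.map π)
    (le_principal_iff.2 (Filter.mem_map.2 (Filter.univ_mem' hmem)))
  have hlim : Tendsto π F (𝓝 π₀) := hπ₀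
  refine ⟨π₀, hlim, ?_, ?_⟩
  · have h₁ := FiniteMeasure.tendsto_map_of_tendsto_of_continuous _ _ hlim
      (continuous_fst (X := X) (Y := X))
    have h₂ : ∀ i, (π i).map Prod.fst = m := fun i ↦ Subtype.ext (hfst i)
    simp only [h₂] at h₁
    have h₃ : π₀.map Prod.fst = m := tendsto_nhds_unique h₁ tendsto_const_nhds
    exact congrArg FiniteMeasure.toMeasure h₃
  · have h₁ := FiniteMeasure.tendsto_map_of_tendsto_of_continuous _ _ hlim
      (continuous_snd (X := X) (Y := X))
    have h₂ : ∀ i, (π i).map Prod.snd = m := fun i ↦ Subtype.ext (hsnd i)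
    simp only [h₂] at h₁
    have h₃ : π₀.map Prod.snd = m := tendsto_nhds_unique h₁ tendsto_const_nhds
    exact congrArg FiniteMeasure.toMeasure h₃

/-- A family of bistochastic kernels has a bistochastic limit along any ultrafilter, in the sense of
convergence of `∫ g * Kf`. -/
lemma exists_isBistochastic_tendsto [T2Space X] [HasOuterApproxClosed X] [NormalSpace X]
    [StandardBorelSpace X] [Nonempty X] [μ.WeaklyRegular] [IsFiniteMeasure μ]
    {K : Set X} (hK : IsCompact K) (hμK : μ Kᶜ = 0)
    {ι : Type*} (F : Ultrafilter ι) {κ : ι → Kernel X X} (hκ : ∀ i, IsBistochastic μ (κ i)) :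
    ∃ κ₀ : Kernel X X, IsBistochastic μ κ₀ ∧ ∀ (g : X →ᵇ ℝ) (f : X → ℝ), Integrable f μ →
      Tendsto (fun i ↦ ∫ x, g x * kernApply (κ i) f x ∂μ) F
        (𝓝 (∫ x, g x * kernApply κ₀ f x ∂μ)) := by
  have (i : ι) := (hκ i).1
  obtain ⟨π₀, hlim, hfst, hsnd⟩ := exists_tendsto_coupling hK hμK F
    (fun i ↦ ⟨μ ⊗ₘ κ i, inferInstance⟩) (fun i ↦ Measure.fst_compProd μ (κ i))
    (fun i ↦ (hκ i).snd_compProd)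
  have hdis : μ ⊗ₘ (π₀ : Measure (X × X)).condKernel = π₀ := by
    conv_lhs => rw [← hfst]
    exact Measure.disintegrate _ _
  have hκ₀ := isBistochastic_of_snd_compProd (hdis.symm ▸ hsnd)
  refine ⟨_, hκ₀, fun g f hf ↦ ?_⟩
  simp only [(hκ _).integral_mul_kernApply g hf, hκ₀.integral_mul_kernApply g hf, hdis]
  exact tendsto_integral_mul_of_snd_eq hlim (fun i ↦ (hκ i).snd_compProd) hsnd g hf

end Bistochastic

/-- the set `𝒦_{ω₀}` of bistochastic images of `ω₀` is convex and
closed in the weak topology `σ(L¹, L^∞)`. -/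
theorem bistochastic_image_convex_weakly_closed
    (M : Set (ℝ × ℝ)) (hMopen : IsOpen M) (hMbdd : Bornology.IsBounded M)
    (ω₀ : ℝ × ℝ → ℝ) (hω₀ : MemLp ω₀ ⊤ (volume.restrict M))
    (𝒦 : Set ((ℝ × ℝ) → ℝ))
    (h𝒦 : 𝒦 = {ω | Integrable ω (volume.restrict M) ∧
        ∃ κ : Kernel (ℝ × ℝ) (ℝ × ℝ), IsBistochastic (volume.restrict M) κ ∧
          ω =ᵐ[volume.restrict M] kernApply κ ω₀}) :
    (∀ ω₁ ∈ 𝒦, ∀ ω₂ ∈ 𝒦, ∀ t : ℝ, t ∈ Set.Icc (0:ℝ) 1 →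
        (fun x => t * ω₁ x + (1 - t) * ω₂ x) ∈ 𝒦) ∧
    (∀ (ωseq : ℕ → (ℝ × ℝ) → ℝ) (ω : (ℝ × ℝ) → ℝ),
        (∀ n, ωseq n ∈ 𝒦) → Integrable ω (volume.restrict M) →
        (∀ g : ℝ × ℝ → ℝ, MemLp g ⊤ (volume.restrict M) →
          Filter.Tendsto (fun n => ∫ x, g x * ωseq n x ∂(volume.restrict M))
            Filter.atTop (nhds (∫ x, g x * ω x ∂(volume.restrict M)))) →
        ω ∈ 𝒦) := by
  have : IsFiniteMeasure (volume.restrict M) := ⟨by simpa using hMbdd.measure_lt_top⟩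
  have hint : Integrable ω₀ (volume.restrict M) := hω₀.integrable le_top
  subst h𝒦
  refine ⟨?_, ?_⟩
  · rintro ω₁ ⟨hi₁, κ, hκ, h₁⟩ ω₂ ⟨hi₂, η, hη, h₂⟩ t ⟨ht₀, ht₁⟩
    refine ⟨(hi₁.const_mul t).add (hi₂.const_mul (1 - t)),
      convexCombKernel (ENNReal.ofReal t) (ENNReal.ofReal (1 - t)) κ η, hκ.convexComb hη ?_, ?_⟩
    · rw [← ENNReal.ofReal_add ht₀ (by linarith)]
      simp
    · filter_upwards [h₁, h₂, hκ.ae_integrable hint, hη.ae_integrable hint] with x e₁ e₂ i₁ i₂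
      rw [kernApply_convexCombKernel i₁ i₂ ENNReal.ofReal_ne_top ENNReal.ofReal_ne_top,
        ENNReal.toReal_ofReal ht₀, ENNReal.toReal_ofReal (by linarith), e₁, e₂]
  · intro ωseq ω hseq hω hlim
    choose _ κ hκ hωκ using hseq
    have hnull : (volume.restrict M) (closure M)ᶜ = 0 := by
      rw [Measure.restrict_apply isClosed_closure.measurableSet.compl,
        (Set.disjoint_compl_left_iff_subset.2 subset_closure).inter_eq, measure_empty]
    obtain ⟨κ₀, hκ₀, hκlim⟩ :=
      exists_isBistochastic_tendsto hMbdd.isCompact_closure hnull (hyperfilter ℕ) hκ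
    refine ⟨hω, κ₀, hκ₀, ?_⟩
    refine ae_eq_of_integral_contDiff_smul_eq hω.locallyIntegrable
      (hκ₀.integrable_kernApply hint).locallyIntegrable fun g hg hgc ↦ ?_
    obtain ⟨C, hC⟩ := hgc.exists_bound_of_continuous hg.continuous
    have h₁ := (hlim g (memLp_top_of_bound hg.continuous.aestronglyMeasurable C
      (ae_of_all _ hC))).mono_left Nat.hyperfilter_le_atTop
    have h₂ := hκlim (BoundedContinuousFunction.ofNormedAddCommGroup g hg.continuous C hC) ω₀ hint
    refine tendsto_nhds_unique h₁ (h₂.congr fun n ↦ integral_congr_ae ?_)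
    filter_upwards [hωκ n] with x hx
    rw [hx]
    rfl
end
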